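/- arXiv:1409.0352 — 3 statements merged into one kernel-verified Lean document; each statement's English description precedes it below -/
import Mathlib

section
/- Let B be a ball in 𝔽₃((X⁻¹)) with radius r(B) ≤ 1 such that B ∩ 𝒞 ≠ ∅. Then the Hausdorff γ-measure of B ∩ 𝒞 equals r(B)^γ, where γ = log 2 / log 3. -/
/-!
Setting: `𝔽₃((X⁻¹))`, the field of formal Laurent series over the field `𝔽₃` with `3` elements,
with absolute value `|f| = 3^N` when `f = ∑_{n ≥ -N} a_{-n} X^{-n}` with `a_N ≠ 0`, `|0| = 0`.
We model it as `LaurentSeries (ZMod 3)` in the variable `t = X⁻¹`, so the coefficient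
`a_{-n}` of `X^{-n}` is the coefficient of `t^n`, and `|f| = 3^{-ord_t f}`.
-/

noncomputable section
open scoped ENNReal Classical

instance : Fact (Nat.Prime 3) := ⟨by norm_num⟩

/-- The field with three elements. -/
abbrev F3 := ZMod 3

/-- The field `𝔽₃((X⁻¹))`, modelled as Laurent series in `t = X⁻¹`. -/
abbrev L3 := LaurentSeries F3

/-- The element `X`, i.e. `t⁻¹`. -/
def XL : L3 := HahnSeries.single (-1 : ℤ) 1

/-- The absolute value: `|f| = 3^{-ord_t f}` for `f ≠ 0` and `|0| = 0`. -/
def absv (f : L3) : ℝ := if f = 0 then 0 else (3 : ℝ) ^ (-f.order)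

/-- The ball of radius `r` around `x` for the ultrametric `d(x, y) = |x - y|`. -/
def ball (x : L3) (r : ℝ) : Set L3 := {y | absv (y - x) < r}

/-- The unit ball `𝕀 = {h : |h| < 1}` around `0`. -/
def unitBall : Set L3 := ball 0 1

/-- The Cantor set `𝒞`: elements of `𝕀` all of whose coefficients `a_{-n}` lie in `{0, 2}`. -/
def Cantor : Set L3 :=
  {f | (∀ m : ℤ, m ≤ 0 → f.coeff m = 0) ∧ ∀ m : ℤ, 1 ≤ m → f.coeff m = 0 ∨ f.coeff m = 2}

/-- `γ = log 2 / log 3`. -/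
def gam : ℝ := Real.log 2 / Real.log 3

/-- The Hausdorff `f`-measure of `A ⊆ 𝔽₃((X⁻¹))`, as defined in the paper:
`ℋ^f(A) = lim_{ρ → 0} inf ∑ᵢ f(r(Bᵢ))`, the infimum being over countable covers of `A`
by balls `Bᵢ` with radius `r(Bᵢ) ≤ ρ`.  Every ball has radius `3^k` for some `k ∈ ℤ`;
a ball is recorded as a pair (centre, k).  (The `⨆` over `ρ` is the limit `ρ → 0`, the inner
infimum being antitone in `ρ`.) -/
def hmeas (f : ℝ → ℝ) (A : Set L3) : ℝ≥0∞ :=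
  ⨆ (ρ : ℝ) (_ : 0 < ρ),
    ⨅ (S : Set (L3 × ℤ)) (_ : S.Countable)
      (_ : ∀ p ∈ S, (3 : ℝ) ^ p.2 ≤ ρ)
      (_ : A ⊆ ⋃ p ∈ S, ball p.1 ((3 : ℝ) ^ p.2)),
      ∑' p : S, ENNReal.ofReal (f ((3 : ℝ) ^ (p : L3 × ℤ).2))

/-- The Hausdorff `γ`-measure `ℋ^γ`. -/
def hgamma (A : Set L3) : ℝ≥0∞ := hmeas (fun r => r ^ gam) A

/-- `μ(A) = ℋ^γ(A ∩ 𝒞)`. -/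
def mu (A : Set L3) : ℝ≥0∞ := hgamma (A ∩ Cantor)

/-- A dimension function: a continuous, non-decreasing `f : ℝ_{≥0} → ℝ_{≥0}` with `f 0 = 0`. -/
structure IsDimFun (f : ℝ → ℝ) : Prop where
  mono : MonotoneOn f (Set.Ici 0)
  cont : ContinuousOn f (Set.Ici 0)
  zero : f 0 = 0
  nonneg : ∀ r, 0 ≤ r → 0 ≤ f r

/-- The image of a polynomial `g ∈ 𝔽₃[X]` in `𝔽₃((X⁻¹))`. -/
def toL (g : Polynomial F3) : L3 := Polynomial.aeval XL g

/-- `ℱ(N)`: polynomials over `𝔽₃` of degree `< N`, all of whose coefficients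
`a_0, …, a_{N-1}` lie in `{0, 2}`. -/
def Fset (N : ℕ) : Set (Polynomial F3) :=
  {g | g.degree < (N : ℕ) ∧ ∀ k < N, g.coeff k = 0 ∨ g.coeff k = 2}

/-- `ℱ*(N)`: members of `ℱ(N)` with `g(0) = 2`. -/
def FsetStar (N : ℕ) : Set (Polynomial F3) :=
  {g | g.degree < (N : ℕ) ∧ (∀ k < N, g.coeff k = 0 ∨ g.coeff k = 2) ∧ g.coeff 0 = 2}

/-- `W_𝒞(ψ)`: elements `h ∈ 𝒞` with `|h - g/X^N| < ψ(3^N)` for infinitely many `N ∈ ℕ`,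
where `g ∈ ℱ(N)`.  Here `ψ N` stands for `ψ(3^N)`. -/
def Wc (ψ : ℕ → ℝ) : Set L3 :=
  {h ∈ Cantor | ∀ m : ℕ, ∃ N : ℕ, m ≤ N ∧ 1 ≤ N ∧
    ∃ g ∈ Fset N, absv (h - toL g / XL ^ N) < ψ N}

/-- `W*_𝒞(ψ)`: defined like `W_𝒞(ψ)`, with `ℱ*(N)` in place of `ℱ(N)`. -/
def WcStar (ψ : ℕ → ℝ) : Set L3 :=
  {h ∈ Cantor | ∀ m : ℕ, ∃ N : ℕ, m ≤ N ∧ 1 ≤ N ∧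
    ∃ g ∈ FsetStar N, absv (h - toL g / XL ^ N) < ψ N}

/-- `A*_n = ⋃_{g ∈ ℱ*(n)} B(g/Xⁿ, ψ(3ⁿ))`. -/
def Astar (ψ : ℕ → ℝ) (n : ℕ) : Set L3 :=
  ⋃ g ∈ FsetStar n, ball (toL g / XL ^ n) (ψ n)

/-- `𝒦(ψ)`: elements `ξ ∈ 𝕀` with `|ξ - g/h| < ψ(|h|)` for infinitely many fractions
`g/h ∈ 𝔽₃(X)`.  Here `ψ d` stands for `ψ(3^d)`, and `|h| = 3^{deg h}`. -/
def Kset (ψ : ℕ → ℝ) : Set L3 :=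
  {ξ ∈ unitBall | {gh : Polynomial F3 × Polynomial F3 | gh.2 ≠ 0 ∧
    absv (ξ - toL gh.1 / toL gh.2) < ψ gh.2.natDegree}.Infinite}

/-- The irrationality exponent
`τ(ξ) = sup {τ : |ξ - g/h| < |h|^{-τ} for infinitely many g/h ∈ 𝔽₃(X)}`, valued in `[0, ∞]`. -/
def irrExp (ξ : L3) : ℝ≥0∞ :=
  sSup {t : ℝ≥0∞ | ∃ τ : ℝ, t = ENNReal.ofReal τ ∧
    {gh : Polynomial F3 × Polynomial F3 | gh.2 ≠ 0 ∧
      absv (ξ - toL gh.1 / toL gh.2) < absv (toL gh.2) ^ (-τ)}.Infinite}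

lemma absv_lt_iff (f : L3) (k : ℤ) :
    absv f < (3 : ℝ) ^ k ↔ ∀ m ≤ -k, f.coeff m = 0 := by
  unfold absv
  split_ifs with h
  · simp only [h, HahnSeries.coeff_zero, implies_true, iff_true]
    positivity
  · rw [zpow_lt_zpow_iff_right₀ (by norm_num)]
    refine ⟨fun hk m hm => HahnSeries.coeff_eq_zero_of_lt_order (by lia), fun H => ?_⟩
    by_contra hk
    exact HahnSeries.coeff_order_eq_zero.not.mpr h (H _ (by lia))

lemma mem_ball_iff (x y : L3) (k : ℤ) :
    y ∈ ball x ((3 : ℝ) ^ k) ↔ ∀ m ≤ -k, y.coeff m = x.coeff m := by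
  simp only [ball, Set.mem_ofPred_eq, absv_lt_iff, HahnSeries.coeff_sub, sub_eq_zero]

/-- A ball is the ball of the same radius around any of its points. -/
lemma ball_eq_ball_of_mem {x y : L3} {k : ℤ} (h : y ∈ ball x ((3 : ℝ) ^ k)) :
    ball x ((3 : ℝ) ^ k) = ball y ((3 : ℝ) ^ k) := by
  rw [mem_ball_iff] at h
  ext z
  simp only [mem_ball_iff]
  exact forall₂_congr fun m hm => by rw [h m hm]

/-- The point of the Cantor set with digit `2` at place `i + 1` when `b i = true`, and digit `0`
otherwise. -/
def cantorPoint (b : ℕ → Bool) : L3 :=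
  HahnSeries.ofSuppBddBelow (fun m : ℤ => if 1 ≤ m ∧ b (m - 1).toNat then 2 else 0)
    ⟨1, fun m hm => by
      by_contra h
      exact hm (if_neg fun h' => h h'.1)⟩

lemma coeff_cantorPoint (b : ℕ → Bool) (m : ℤ) :
    (cantorPoint b).coeff m = if 1 ≤ m ∧ b (m - 1).toNat then 2 else 0 := rfl

lemma cantorPoint_mem (b : ℕ → Bool) : cantorPoint b ∈ Cantor := by
  refine ⟨fun m hm => ?_, fun m hm => ?_⟩ <;> rw [coeff_cantorPoint]
  · exact if_neg fun h => by lia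
  · split_ifs <;> simp

lemma exists_cantorPoint_eq {y : L3} (hy : y ∈ Cantor) : ∃ b, cantorPoint b = y := by
  refine ⟨fun i => decide (y.coeff (i + 1) = 2), ?_⟩
  ext m
  rw [coeff_cantorPoint]
  rcases le_or_gt m 0 with hm | hm
  · rw [if_neg fun h => by lia, hy.1 m hm]
  · have e : (((m - 1).toNat : ℕ) : ℤ) + 1 = m := by lia
    simp only [e, decide_eq_true_eq]
    rcases hy.2 m hm with h | h
    · rw [h, if_neg]
      exact fun h' => absurd h'.2 (by decide)
    · rw [h, if_pos ⟨hm, rfl⟩]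

lemma cantorPoint_mem_ball_iff (b c : ℕ → Bool) (n : ℕ) :
    cantorPoint b ∈ ball (cantorPoint c) ((3 : ℝ) ^ (-n : ℤ)) ↔ ∀ i < n, b i = c i := by
  simp only [mem_ball_iff, coeff_cantorPoint, neg_neg]
  have h2 : (2 : F3) ≠ 0 := by decide
  refine ⟨fun H i hi => ?_, fun H m hm => ?_⟩
  · have := H (i + 1) (by lia)
    cases hb : b i <;> cases hc : c i <;> simp_all
  · by_cases h : 1 ≤ m
    · rw [H _ (by lia)]
    · simp [h]

lemma ofReal_three_zpow_rpow_gam (n : ℕ) :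
    ENNReal.ofReal (((3 : ℝ) ^ (-n : ℤ)) ^ gam) = (2⁻¹ : ℝ≥0∞) ^ n := by
  have h : ((3 : ℝ) ^ (-n : ℤ)) ^ gam = (2⁻¹ : ℝ) ^ n := by
    have h3 : (3 : ℝ) ^ gam = 2 := by
      have : Real.log 3 ≠ 0 := (Real.log_pos (by norm_num)).ne'
      rw [Real.rpow_def_of_pos (by norm_num), gam, mul_div_cancel₀ _ this,
        Real.exp_log (by norm_num)]
    rw [← Real.rpow_intCast, ← Real.rpow_mul (by norm_num), mul_comm,
      Real.rpow_mul (by norm_num), h3, Real.rpow_intCast, zpow_neg, zpow_natCast, inv_pow]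
  rw [h, ENNReal.ofReal_pow (by norm_num), ENNReal.ofReal_inv_of_pos (by norm_num),
    ENNReal.ofReal_ofNat]

/-- The law of a sequence of independent fair coin flips. -/
def coinMeasure : MeasureTheory.Measure (ℕ → Bool) :=
  MeasureTheory.Measure.infinitePi fun _ => (PMF.uniformOfFintype Bool).toMeasure

lemma coinMeasure_setOf_agree (b : ℕ → Bool) (n : ℕ) :
    coinMeasure {c | ∀ i < n, c i = b i} = (2⁻¹ : ℝ≥0∞) ^ n := by
  have : {c : ℕ → Bool | ∀ i < n, c i = b i}
      = Set.pi (Finset.range n : Finset ℕ) fun i => {b i} := by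
    ext c
    simp
  rw [this, coinMeasure, MeasureTheory.Measure.infinitePi_pi _ fun _ _ => .singleton _]
  simp

lemma coinMeasure_preimage_ball_le (x : L3) (n : ℕ) :
    coinMeasure (cantorPoint ⁻¹' ball x ((3 : ℝ) ^ (-n : ℤ))) ≤ (2⁻¹ : ℝ≥0∞) ^ n := by
  rcases (cantorPoint ⁻¹' ball x ((3 : ℝ) ^ (-n : ℤ))).eq_empty_or_nonempty with h | ⟨b, hb⟩
  · rw [h, MeasureTheory.measure_empty]
    exact zero_le
  · rw [ball_eq_ball_of_mem hb, ← coinMeasure_setOf_agree b n]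
    exact MeasureTheory.measure_mono fun c hc => (cantorPoint_mem_ball_iff c b n).1 hc

lemma le_hgamma_ball_inter_cantor (b : ℕ → Bool) (n : ℕ) :
    (2⁻¹ : ℝ≥0∞) ^ n ≤ hgamma (ball (cantorPoint b) ((3 : ℝ) ^ (-n : ℤ)) ∩ Cantor) := by
  refine le_iSup₂_of_le (1 : ℝ) one_pos (le_iInf₂ fun S hS => le_iInf₂ fun hρ hcov => ?_)
  have : Countable S := hS
  calc (2⁻¹ : ℝ≥0∞) ^ n = coinMeasure {c | ∀ i < n, c i = b i} :=
        (coinMeasure_setOf_agree b n).symm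
    _ ≤ coinMeasure (⋃ p : S, cantorPoint ⁻¹' ball p.1.1 ((3 : ℝ) ^ p.1.2)) := by
        refine MeasureTheory.measure_mono fun c hc => ?_
        have := hcov ⟨(cantorPoint_mem_ball_iff c b n).2 hc, cantorPoint_mem c⟩
        simpa using this
    _ ≤ ∑' p : S, coinMeasure (cantorPoint ⁻¹' ball p.1.1 ((3 : ℝ) ^ p.1.2)) :=
        MeasureTheory.measure_iUnion_le _
    _ ≤ _ := by
        refine ENNReal.tsum_le_tsum fun p => ?_
        obtain ⟨m, hm⟩ : ∃ m : ℕ, p.1.2 = -m :=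
          ⟨(-p.1.2).toNat, by
            have := (zpow_le_one_iff_right₀ (by norm_num : (1 : ℝ) < 3)).1 (hρ p.1 p.2)
            lia⟩
        simp only [hm]
        rw [ofReal_three_zpow_rpow_gam]
        exact coinMeasure_preimage_ball_le _ _

lemma hgamma_ball_inter_cantor_le (b : ℕ → Bool) (n : ℕ) :
    hgamma (ball (cantorPoint b) ((3 : ℝ) ^ (-n : ℤ)) ∩ Cantor) ≤ (2⁻¹ : ℝ≥0∞) ^ n := by
  refine iSup₂_le fun ρ hρ => ?_
  obtain ⟨j, hj⟩ := exists_pow_lt_of_lt_one hρ (by norm_num : (3⁻¹ : ℝ) < 1)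
  let extend (s : Fin j → Bool) (i : ℕ) : Bool :=
    if h : n ≤ i ∧ i < n + j then s ⟨i - n, by lia⟩ else b i
  let g (s : Fin j → Bool) : L3 × ℤ := (cantorPoint (extend s), -(n + j : ℕ))
  refine iInf₂_le_of_le (Set.range g) (Set.countable_range g) (iInf₂_le_of_le ?_ ?_ ?_)
  · rintro _ ⟨s, rfl⟩
    refine le_trans ?_ hj.le
    rw [zpow_neg, zpow_natCast, ← inv_pow]
    exact pow_le_pow_of_le_one (by norm_num) (by norm_num) (by lia)
  · rintro y ⟨hyb, hyc⟩
    obtain ⟨c, rfl⟩ := exists_cantorPoint_eq hyc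
    rw [cantorPoint_mem_ball_iff] at hyb
    let s (i : Fin j) : Bool := c (n + i)
    refine Set.mem_iUnion₂.2 ⟨g s, Set.mem_range_self s,
      (cantorPoint_mem_ball_iff _ _ _).2 fun i hi => ?_⟩
    by_cases h : n ≤ i
    · simp [extend, s, h, hi]
    · simp [extend, h, hyb i (by lia)]
  · calc _ = ∑' _ : Set.range g, (2⁻¹ : ℝ≥0∞) ^ (n + j) := by
          refine tsum_congr ?_
          rintro ⟨_, s, rfl⟩
          exact ofReal_three_zpow_rpow_gam _
      _ = (Set.range g).encard * (2⁻¹ : ℝ≥0∞) ^ (n + j) := ENNReal.tsum_set_const _ _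
      _ ≤ (2 : ℝ≥0∞) ^ j * (2⁻¹ : ℝ≥0∞) ^ (n + j) := by
          gcongr
          have h : (Set.range g).encard ≤ ((2 ^ j : ℕ) : ℕ∞) := by
            rw [← Set.image_univ]
            refine (Set.encard_image_le g _).trans ?_
            simp [Set.encard_univ]
          exact_mod_cast (ENat.toENNReal_le.2 h)
      _ = (2⁻¹ : ℝ≥0∞) ^ n := by
          rw [pow_add, mul_left_comm, ← mul_pow, ENNReal.mul_inv_cancel (by simp) (by simp),
            one_pow, mul_one]

/-- For any ball `B` in `𝔽₃((X⁻¹))` with radius `r(B) = 3^k ≤ 1` and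
`B ∩ 𝒞 ≠ ∅`, one has `ℋ^γ(B ∩ 𝒞) = r(B)^γ`. -/
theorem hgamma_ball_inter_cantor (x : L3) (k : ℤ) (hr : (3 : ℝ) ^ k ≤ 1)
    (hne : (ball x ((3 : ℝ) ^ k) ∩ Cantor).Nonempty) :
    hgamma (ball x ((3 : ℝ) ^ k) ∩ Cantor) = ENNReal.ofReal (((3 : ℝ) ^ k) ^ gam) := by
  obtain ⟨y, hyb, hyc⟩ := hne
  obtain ⟨b, rfl⟩ := exists_cantorPoint_eq hyc
  obtain ⟨n, rfl⟩ : ∃ n : ℕ, k = -n :=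
    ⟨(-k).toNat, by
      have := (zpow_le_one_iff_right₀ (by norm_num : (1 : ℝ) < 3)).1 hr
      lia⟩
  rw [ball_eq_ball_of_mem hyb, ofReal_three_zpow_rpow_gam]
  exact le_antisymm (hgamma_ball_inter_cantor_le b n) (le_hgamma_ball_inter_cantor b n)
end
end

section
/- Let f be a dimension function such that r ↦ r^{-γ} f(r) is monotonic, and suppose ∑_{n=1}^∞ f(ψ(3^n)) · (3^n)^γ < ∞. Then ℋ^f(W_𝒞(ψ)) = 0. -/
/-!
Setting: `𝔽₃((X⁻¹))`, the field of formal Laurent series over the field `𝔽₃` with `3` elements,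
with absolute value `|f| = 3^N` when `f = ∑_{n ≥ -N} a_{-n} X^{-n}` with `a_N ≠ 0`, `|0| = 0`.
We model it as `LaurentSeries (ZMod 3)` in the variable `t = X⁻¹`, so the coefficient
`a_{-n}` of `X^{-n}` is the coefficient of `t^n`, and `|f| = 3^{-ord_t f}`.
-/

noncomputable section
open scoped ENNReal Classical

lemma three_pow_rpow_gam (n : ℕ) : ((3 : ℝ) ^ n) ^ gam = 2 ^ n := by
  have h : (3 : ℝ) ^ gam = 2 := by
    have h3 : Real.log 3 ≠ 0 := (Real.log_pos (by norm_num)).ne'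
    rw [Real.rpow_def_of_pos (by norm_num), gam, mul_div_cancel₀ _ h3,
      Real.exp_log (by norm_num)]
  rw [← Real.rpow_natCast, ← Real.rpow_mul (by norm_num), mul_comm,
    Real.rpow_mul (by norm_num), h, Real.rpow_natCast]

/-- A polynomial in `ℱ(N)` is determined by the set of positions of its coefficients `2`. -/
lemma encard_Fset_le (N : ℕ) : (Fset N).encard ≤ 2 ^ N := by
  have hinj : Set.InjOn (fun g : Polynomial F3 => (Finset.range N).filter (g.coeff · = 2))
      (Fset N) := by
    intro g hg g' hg' h
    ext k
    by_cases hk : k < N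
    · have hiff : g.coeff k = 2 ↔ g'.coeff k = 2 := by
        simpa [hk] using Finset.ext_iff.mp h k
      rcases hg.2 k hk with h0 | h2
      · rcases hg'.2 k hk with h0' | h2'
        · rw [h0, h0']
        · rw [hiff.mpr h2', h2']
      · rw [h2, hiff.mp h2]
    · have hk' : (N : WithBot ℕ) ≤ (k : WithBot ℕ) := by exact_mod_cast not_lt.mp hk
      rw [Polynomial.coeff_eq_zero_of_degree_lt (hg.1.trans_le hk'),
        Polynomial.coeff_eq_zero_of_degree_lt (hg'.1.trans_le hk')]
  rw [← hinj.encard_image]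
  calc _ ≤ ((Finset.range N).powerset : Set (Finset ℕ)).encard := by
        refine Set.encard_le_encard ?_
        rintro _ ⟨g, -, rfl⟩
        exact Finset.mem_coe.mpr (Finset.mem_powerset.mpr (Finset.filter_subset _ _))
    _ = 2 ^ N := by
        rw [Set.encard_coe_eq_coe_finsetCard, Finset.card_powerset, Finset.card_range]
        norm_cast

lemma absv_lt_of_coeff_eq_zero {h : L3} {k : ℤ} (hk : ∀ m ≤ -k, h.coeff m = 0) :
    absv h < (3 : ℝ) ^ k := by
  unfold absv
  split_ifs with h0
  · positivity
  · refine zpow_lt_zpow_right₀ (by norm_num) ?_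
    by_contra hlt
    exact HahnSeries.coeff_order_eq_zero.not.mpr h0 (hk _ (by omega))

/-- The finite sum `∑ 2 X^{-i}` over `i ∈ s`. -/
def twoSum (s : Finset ℕ) : L3 := ∑ i ∈ s, HahnSeries.single (i : ℤ) (2 : F3)

lemma coeff_twoSum (s : Finset ℕ) (n : ℕ) :
    (twoSum s).coeff n = if n ∈ s then 2 else 0 := by
  simp [twoSum, HahnSeries.coeff_sum, HahnSeries.coeff_single, Finset.sum_ite_eq]

lemma coeff_twoSum_of_neg (s : Finset ℕ) {m : ℤ} (hm : m < 0) : (twoSum s).coeff m = 0 := by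
  rw [twoSum, HahnSeries.coeff_sum]
  exact Finset.sum_eq_zero fun i _ => HahnSeries.coeff_single_of_ne (by omega)

lemma exists_mem_ball_twoSum {h : L3} (hh : h ∈ Cantor) (k : ℤ) :
    ∃ s : Finset ℕ, h ∈ ball (twoSum s) ((3 : ℝ) ^ k) := by
  refine ⟨(Finset.range ((-k).toNat + 1)).filter (fun n : ℕ => h.coeff (n : ℤ) = 2),
    absv_lt_of_coeff_eq_zero fun m hm => ?_⟩
  rw [HahnSeries.coeff_sub]
  rcases lt_or_ge m 0 with hneg | hpos
  · rw [hh.1 m hneg.le, coeff_twoSum_of_neg _ hneg, sub_zero]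
  · lift m to ℕ using hpos
    have hmem : m ∈ Finset.range ((-k).toNat + 1) := by
      rw [Finset.mem_range]
      omega
    rw [coeff_twoSum]
    split_ifs with h2
    · rw [(Finset.mem_filter.mp h2).2, sub_self]
    · rcases Nat.eq_zero_or_pos m with rfl | hm0
      · rw [sub_zero]
        exact hh.1 _ le_rfl
      · rw [sub_zero]
        exact (hh.2 m (by exact_mod_cast hm0)).resolve_right fun h' =>
          h2 (Finset.mem_filter.mpr ⟨hmem, h'⟩)

/-- If covers with arbitrarily small balls and arbitrarily small cost exist, then the
Hausdorff measure vanishes. -/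
lemma hmeas_eq_zero {f : ℝ → ℝ} {A : Set L3}
    (h : ∀ ρ : ℝ, 0 < ρ → ∀ ε : ℝ≥0∞, 0 < ε → ∃ S : Set (L3 × ℤ), S.Countable ∧
      (∀ p ∈ S, (3 : ℝ) ^ p.2 ≤ ρ) ∧ A ⊆ (⋃ p ∈ S, ball p.1 ((3 : ℝ) ^ p.2)) ∧
      ∑' p : S, ENNReal.ofReal (f ((3 : ℝ) ^ (p : L3 × ℤ).2)) ≤ ε) :
    hmeas f A = 0 := by
  refine le_antisymm (iSup₂_le fun ρ hρ => ?_) zero_le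
  refine le_of_forall_gt_imp_ge_of_dense fun ε hε => ?_
  obtain ⟨S, hS, hSρ, hA, hle⟩ := h ρ hρ ε hε
  exact iInf₂_le_of_le S hS (iInf₂_le_of_le hSρ hA hle)

/-- Subsets of the Cantor set are null for `f` vanishing near `0`. -/
lemma hmeas_eq_zero_of_vanishing {f : ℝ → ℝ} {A : Set L3} (hA : A ⊆ Cantor) {r : ℝ} (hr : 0 < r)
    (hf : ∀ x, 0 < x → x ≤ r → f x = 0) : hmeas f A = 0 := by
  refine hmeas_eq_zero fun ρ hρ ε _ => ?_
  obtain ⟨n, hn⟩ := exists_pow_lt_of_lt_one (lt_min hρ hr) (show (3 : ℝ)⁻¹ < 1 by norm_num)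
  have hk : (3 : ℝ) ^ (-(n : ℤ)) < min ρ r := by
    rwa [zpow_neg, zpow_natCast, ← inv_pow]
  refine ⟨Set.range fun s : Finset ℕ => (twoSum s, -(n : ℤ)), Set.countable_range _, ?_, ?_, ?_⟩
  · rintro _ ⟨s, rfl⟩
    exact (hk.trans_le (min_le_left _ _)).le
  · intro h hh
    obtain ⟨s, hs⟩ := exists_mem_ball_twoSum (hA hh) (-(n : ℤ))
    exact Set.mem_biUnion (Set.mem_range_self s) hs
  · refine (ENNReal.tsum_eq_zero.mpr ?_).trans_le zero_le
    rintro ⟨_, s, rfl⟩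
    rw [hf _ (by positivity) (hk.trans_le (min_le_right _ _)).le, ENNReal.ofReal_zero]

/-- convergence case of the Khintchine-type theorem.
If `f` is a dimension function with `r ↦ r^{-γ} f(r)` monotonic and
`∑_{n ≥ 1} f(ψ(3^n)) (3^n)^γ < ∞`, then `ℋ^f(W_𝒞(ψ)) = 0`. -/
theorem khintchine_convergence (f : ℝ → ℝ) (hf : IsDimFun f)
    (hfmono : MonotoneOn (fun r => r ^ (-gam) * f r) (Set.Ioi (0 : ℝ)) ∨
      AntitoneOn (fun r => r ^ (-gam) * f r) (Set.Ioi (0 : ℝ)))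
    (ψ : ℕ → ℝ) (hψ : ∀ n : ℕ, 1 ≤ n → ∃ r : ℤ, ψ n = (3 : ℝ) ^ (-r))
    (hconv : ∑' n : ℕ, ENNReal.ofReal (f (ψ (n + 1)) * ((3 : ℝ) ^ (n + 1)) ^ gam) ≠ ⊤) :
    hmeas f (Wc ψ) = 0 := by
  by_cases hvan : ∃ r, 0 < r ∧ f r = 0
  · obtain ⟨r, hr, hr0⟩ := hvan
    refine hmeas_eq_zero_of_vanishing (fun h hh => hh.1) hr fun x hx hxr => ?_
    exact le_antisymm (hr0 ▸ hf.mono hx.le hr.le hxr) (hf.nonneg x hx.le)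
  push Not at hvan
  refine hmeas_eq_zero fun ρ hρ ε hε => ?_
  have hfρ : 0 < f ρ := lt_of_le_of_ne (hf.nonneg ρ hρ.le) (hvan ρ hρ).symm
  have hψpos : ∀ n, 1 ≤ n → 0 < ψ n := fun n hn => by
    obtain ⟨r, hr⟩ := hψ n hn
    rw [hr]
    positivity
  obtain ⟨M, hM⟩ := ((ENNReal.tendsto_sum_nat_add _ hconv).eventually_lt_const
    (lt_min hε (ENNReal.ofReal_pos.mpr hfρ))).exists
  simp only [three_pow_rpow_gam] at hM
  choose r hr using fun n : ℕ => hψ (n + M + 1) (by omega)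
  have hle : ∀ n, ψ (n + M + 1) ≤ ρ := by
    intro n
    by_contra! hlt
    have hpos := hψpos (n + M + 1) (by omega)
    have h1 : f ρ ≤ f (ψ (n + M + 1)) * 2 ^ (n + M + 1) :=
      (hf.mono hρ.le hpos.le hlt.le).trans
        (le_mul_of_one_le_right (hf.nonneg _ hpos.le) (one_le_pow₀ (by norm_num)))
    have h2 := (ENNReal.ofReal_le_ofReal h1).trans (ENNReal.le_tsum (f := fun n =>
      ENNReal.ofReal (f (ψ (n + M + 1)) * 2 ^ (n + M + 1))) n)
    exact (h2.trans_lt (hM.trans_le (min_le_right _ _))).false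
  have hfin : ∀ N, (Fset N).Finite := fun N =>
    Set.finite_of_encard_le_coe (k := 2 ^ N) (by exact_mod_cast encard_Fset_le N)
  refine ⟨⋃ n, (fun g => (toL g / XL ^ (n + M + 1), -r n)) '' Fset (n + M + 1),
    Set.countable_iUnion fun n => ((hfin _).image _).countable, ?_, ?_, ?_⟩
  · intro p hp
    obtain ⟨n, g, -, rfl⟩ := Set.mem_iUnion.mp hp
    exact (hr n).symm.trans_le (hle n)
  · intro h hh
    obtain ⟨N, hN, -, g, hg, hlt⟩ := hh.2 (M + 1)
    obtain ⟨n, rfl⟩ : ∃ n, N = n + M + 1 := ⟨N - (M + 1), by omega⟩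
    refine Set.mem_biUnion (Set.mem_iUnion.mpr ⟨n, g, hg, rfl⟩) ?_
    rw [hr n] at hlt
    exact hlt
  · refine (ENNReal.tsum_iUnion_le_tsum
      (fun p : L3 × ℤ => ENNReal.ofReal (f ((3 : ℝ) ^ p.2))) _).trans
      ((ENNReal.tsum_le_tsum fun n => ?_).trans (hM.trans_le (min_le_left _ _)).le)
    set T := (fun g => (toL g / XL ^ (n + M + 1), -r n)) '' Fset (n + M + 1)
    have hcard : (T.encard : ℝ≥0∞) ≤ 2 ^ (n + M + 1) := by
      have h : T.encard ≤ 2 ^ (n + M + 1) :=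
        (Set.encard_image_le _ _).trans (encard_Fset_le (n + M + 1))
      exact_mod_cast ENat.toENNReal_mono h
    calc ∑' p : T, ENNReal.ofReal (f ((3 : ℝ) ^ (p : L3 × ℤ).2))
        = ∑' _ : T, ENNReal.ofReal (f (ψ (n + M + 1))) := by
          refine tsum_congr ?_
          rintro ⟨_, g, -, rfl⟩
          rw [hr n]
      _ = T.encard * ENNReal.ofReal (f (ψ (n + M + 1))) := by
          rw [ENNReal.tsum_const]
          rfl
      _ ≤ 2 ^ (n + M + 1) * ENNReal.ofReal (f (ψ (n + M + 1))) := by gcongr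
      _ = ENNReal.ofReal (f (ψ (n + M + 1)) * 2 ^ (n + M + 1)) := by
          rw [mul_comm, ENNReal.ofReal_mul (hf.nonneg _ (hψpos _ (by omega)).le),
            ENNReal.ofReal_pow (by norm_num), ENNReal.ofReal_ofNat]
end
end

section
/- Suppose ψ(3^n) ≤ 3^{-n} for all n ∈ ℕ. Let B be a ball in 𝔽₃((X⁻¹)) with radius r(B) = 3^{-ℓ} ≤ 1 and B ∩ 𝒞 ≠ ∅, and let n > ℓ. Then the number of polynomials g ∈ ℱ*(n) such that B(g/Xⁿ, ψ(3ⁿ)) ⊆ B equals 2^{n − ℓ − 1}. -/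
/-!
Setting: `𝔽₃((X⁻¹))`, the field of formal Laurent series over the field `𝔽₃` with `3` elements,
with absolute value `|f| = 3^N` when `f = ∑_{n ≥ -N} a_{-n} X^{-n}` with `a_N ≠ 0`, `|0| = 0`.
We model it as `LaurentSeries (ZMod 3)` in the variable `t = X⁻¹`, so the coefficient
`a_{-n}` of `X^{-n}` is the coefficient of `t^n`, and `|f| = 3^{-ord_t f}`.
-/

noncomputable section
open scoped ENNReal Classical

theorem absv_lt_zpow_iff (f : L3) (k : ℤ) :
    absv f < (3 : ℝ) ^ (-k) ↔ ∀ m ≤ k, f.coeff m = 0 := by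
  unfold absv
  split_ifs with h
  · subst h
    simp only [HahnSeries.coeff_zero, implies_true, iff_true]
    positivity
  · rw [zpow_lt_zpow_iff_right₀ (by norm_num), neg_lt_neg_iff]
    constructor
    · intro hk m hm
      exact HahnSeries.coeff_eq_zero_of_lt_order (by omega)
    · intro hf
      by_contra! hk
      exact h (HahnSeries.leadingCoeff_eq_zero.mp
        (by rw [HahnSeries.leadingCoeff_eq]; exact hf _ hk))

theorem mem_ball_zpow_iff (x y : L3) (k : ℤ) :
    y ∈ ball x ((3 : ℝ) ^ (-k)) ↔ ∀ m ≤ k, y.coeff m = x.coeff m := by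
  simp only [ball, Set.mem_ofPred_eq, absv_lt_zpow_iff, HahnSeries.coeff_sub, sub_eq_zero]

theorem mem_ball_self {r : ℝ} (hr : 0 < r) (x : L3) : x ∈ ball x r := by
  simpa [ball, absv] using hr

theorem XL_pow (k : ℕ) : XL ^ k = HahnSeries.single (-(k : ℤ)) 1 := by
  simp [XL, HahnSeries.single_pow]

theorem toL_div_XL_pow_coeff (g : Polynomial F3) (n k : ℕ) :
    (toL g / XL ^ n).coeff ((n : ℤ) - k) = g.coeff k := by
  have hinv : (XL ^ n)⁻¹ = HahnSeries.single (n : ℤ) (1 : F3) := by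
    rw [XL_pow, HahnSeries.inv_single]; simp
  rw [div_eq_mul_inv, hinv, sub_eq_neg_add, HahnSeries.coeff_mul_single_add, mul_one]
  induction g using Polynomial.induction_on' with
  | add p q hp hq => simpa [toL] using congrArg₂ (· + ·) hp hq
  | monomial j a =>
    have h : toL (Polynomial.monomial j a) = HahnSeries.single (-(j : ℤ)) a := by
      rw [toL, Polynomial.aeval_monomial, XL_pow, show algebraMap F3 L3 a = HahnSeries.C a from
          RingHom.congr_fun (Subsingleton.elim _ _) a,
        HahnSeries.C_apply, HahnSeries.single_mul_single, zero_add, mul_one]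
    rw [h, HahnSeries.coeff_single, Polynomial.coeff_monomial]
    simp [eq_comm]

theorem toL_div_XL_pow_coeff_of_nonpos {g : Polynomial F3} {n : ℕ} (hg : g.degree < (n : ℕ))
    {m : ℤ} (hm : m ≤ 0) : (toL g / XL ^ n).coeff m = 0 := by
  obtain ⟨k, rfl⟩ : ∃ k : ℕ, m = (n : ℤ) - k := ⟨((n : ℤ) - m).toNat, by omega⟩
  rw [toL_div_XL_pow_coeff]
  exact Polynomial.coeff_eq_zero_of_degree_lt (hg.trans_le (by exact_mod_cast (by omega : n ≤ k)))

theorem ball_toL_subset_iff {r : ℝ} {c : L3} (hc : c ∈ Cantor) {g : Polynomial F3} {n ℓ : ℕ}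
    (hg : g.degree < (n : ℕ)) (hr : 0 < r) (hrn : r ≤ (3 : ℝ) ^ (-(n : ℤ))) (hn : ℓ < n) {x : L3}
    (hx : c ∈ ball x ((3 : ℝ) ^ (-(ℓ : ℤ)))) :
    ball (toL g / XL ^ n) r ⊆ ball x ((3 : ℝ) ^ (-(ℓ : ℤ))) ↔
      ∀ k < n, n - ℓ ≤ k → g.coeff k = c.coeff ((n : ℤ) - k) := by
  rw [mem_ball_zpow_iff] at hx
  constructor
  · intro h k hk hk'
    have := (mem_ball_zpow_iff _ _ _).mp (h (mem_ball_self hr _)) ((n : ℤ) - k) (by omega)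
    rw [toL_div_XL_pow_coeff] at this
    rw [this, hx _ (by omega)]
  · intro h y hy
    have hy' := (mem_ball_zpow_iff _ y n).mp (lt_of_lt_of_le hy hrn)
    rw [mem_ball_zpow_iff]
    intro m hm
    rw [hy' m (by omega), ← hx m hm]
    rcases le_or_gt m 0 with h0 | h0
    · rw [toL_div_XL_pow_coeff_of_nonpos hg h0, hc.1 m h0]
    · obtain ⟨k, rfl⟩ : ∃ k : ℕ, m = (n : ℤ) - k := ⟨((n : ℤ) - m).toNat, by omega⟩
      rw [toL_div_XL_pow_coeff, h k (by omega) (by omega)]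

theorem ncard_FsetStar_prescribed (b : ℕ → F3) {n d : ℕ} (hd : 0 < d) (hdn : d ≤ n)
    (hb : ∀ k < n, d ≤ k → b k = 0 ∨ b k = 2) :
    {g ∈ FsetStar n | ∀ k < n, d ≤ k → g.coeff k = b k}.ncard = 2 ^ (d - 1) := by
  let a : Finset ℕ → ℕ → F3 := fun S k =>
    if k = 0 then 2 else if k < d then (if k ∈ S then 2 else 0) else b k
  let p : Finset ℕ → Polynomial F3 := fun S =>
    ∑ k ∈ Finset.range n, Polynomial.monomial k (a S k)
  have hp (S : Finset ℕ) (k : ℕ) : (p S).coeff k = if k < n then a S k else 0 := by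
    simp [p, Polynomial.finsetSum_coeff, Polynomial.coeff_monomial]
  have himg : {g ∈ FsetStar n | ∀ k < n, d ≤ k → g.coeff k = b k} =
      p '' ((Finset.Ioo 0 d).powerset : Set (Finset ℕ)) := by
    ext g
    constructor
    · rintro ⟨⟨hdeg, hcoeff, h0⟩, hfix⟩
      refine ⟨(Finset.Ioo 0 d).filter (fun k => g.coeff k = 2), ?_, ?_⟩
      · exact Finset.mem_coe.mpr (Finset.mem_powerset.mpr (Finset.filter_subset _ _))
      · ext k
        rw [hp]
        split_ifs with hk
        · simp only [a, Finset.mem_filter, Finset.mem_Ioo]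
          split_ifs with h1 h2 h3
          · rw [h1, h0]
          · exact h3.2.symm
          · exact ((hcoeff k hk).resolve_right fun h => h3 ⟨⟨by omega, h2⟩, h⟩).symm
          · exact (hfix k hk (by omega)).symm
        · exact (Polynomial.coeff_eq_zero_of_degree_lt
            (hdeg.trans_le (by exact_mod_cast not_lt.mp hk))).symm
    · rintro ⟨S, -, rfl⟩
      refine ⟨⟨?_, ?_, ?_⟩, ?_⟩
      · rw [Polynomial.degree_lt_iff_coeff_zero]
        intro k hk
        rw [hp, if_neg (by omega)]
      · intro k hk
        rw [hp, if_pos hk]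
        simp only [a]
        split_ifs with h1 h2 h3
        · exact Or.inr rfl
        · exact Or.inr rfl
        · exact Or.inl rfl
        · exact hb k hk (by omega)
      · rw [hp, if_pos (by omega)]
        simp [a]
      · intro k hk hk'
        rw [hp, if_pos hk]
        simp only [a]
        rw [if_neg (by omega), if_neg (by omega)]
  have hinj : Set.InjOn p ((Finset.Ioo 0 d).powerset : Set (Finset ℕ)) := by
    intro S hS T hT hST
    have h20 : (2 : F3) ≠ 0 := by decide
    simp only [Finset.coe_powerset, Set.mem_preimage, Set.mem_powerset_iff,
      Finset.coe_subset] at hS hT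
    ext k
    by_cases hk : k ∈ Finset.Ioo 0 d
    · have h := congrArg (fun q => Polynomial.coeff q k) hST
      rw [Finset.mem_Ioo] at hk
      simp only [hp, a, if_pos (hk.2.trans_le hdn), if_neg hk.1.ne', if_pos hk.2] at h
      by_cases h1 : k ∈ S <;> by_cases h2 : k ∈ T <;> simp_all
    · exact iff_of_false (fun h => hk (hS h)) (fun h => hk (hT h))
  rw [himg, hinj.ncard_image, Set.ncard_coe_finset, Finset.card_powerset,
    Nat.card_Ioo, Nat.sub_zero]

/-- Assume `ψ(3^n) ≤ 3^{-n}` for all `n`.  If `B` is a ball with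
radius `r(B) = 3^{-ℓ} ≤ 1` and `B ∩ 𝒞 ≠ ∅`, and `n > ℓ`, then the number of `g ∈ ℱ*(n)`
with `B(g/Xⁿ, ψ(3ⁿ)) ⊆ B` equals `2^{n - ℓ - 1}`. -/
theorem card_balls_in_ball (ψ : ℕ → ℝ)
    (hψ : ∀ n : ℕ, 1 ≤ n → ∃ r : ℤ, ψ n = (3 : ℝ) ^ (-r))
    (hle : ∀ n : ℕ, 1 ≤ n → ψ n ≤ (3 : ℝ) ^ (-(n : ℤ)))
    (x : L3) (ℓ : ℕ) (hne : (ball x ((3 : ℝ) ^ (-(ℓ : ℤ))) ∩ Cantor).Nonempty)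
    (n : ℕ) (hn : ℓ < n) :
    {g ∈ FsetStar n |
        ball (toL g / XL ^ n) (ψ n) ⊆ ball x ((3 : ℝ) ^ (-(ℓ : ℤ)))}.ncard
      = 2 ^ (n - ℓ - 1) := by
  obtain ⟨c, hcx, hc⟩ := hne
  have hn1 : 1 ≤ n := by omega
  have hpos : 0 < ψ n := by
    obtain ⟨r, hr⟩ := hψ n hn1
    rw [hr]
    positivity
  rw [← ncard_FsetStar_prescribed (fun k => c.coeff ((n : ℤ) - k)) (n := n) (by omega)
    (Nat.sub_le n ℓ) fun k hk _ => hc.2 _ (by omega)]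
  congr 1
  ext g
  exact and_congr_right fun hg => ball_toL_subset_iff hc hg.1 hpos (hle n hn1) hn hcx
end
end
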